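/- For every ε > 0 and every M, there exists n and a total Boolean function f : {0,1}^n → {0,1} such that UC(f) ≥ M and R(f) ≥ UC(f)^(2−ε). (That is, bounded-error randomized query complexity can be nearly quadratically larger than subcube partition complexity, matching the upper bound R(f) = O(UC(f)²) up to lower-order terms.) -/

import Mathlib

/-! ### Partial assignments and certificate complexity -/

/-- An input `x` is consistent with a partial assignment `p` if it agrees with
`p` wherever `p` is defined. -/
def Consistent {n : ℕ} (x : Fin n → Bool) (p : Fin n → Option Bool) : Prop :=
  ∀ i : Fin n, ∀ b : Bool, p i = some b → x i = b

instance {n : ℕ} (x : Fin n → Bool) (p : Fin n → Option Bool) :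
    Decidable (Consistent x p) := by unfold Consistent; infer_instance

/-- The width of a partial assignment: the number of fixed coordinates. -/
def paWidth {n : ℕ} (p : Fin n → Option Bool) : ℕ :=
  (Finset.univ.filter (fun i : Fin n => (p i).isSome)).card

/-- `p` is a `b`-certificate for `f`: every input consistent with `p` has value `b`. -/
def IsCert {n : ℕ} (f : (Fin n → Bool) → Bool) (b : Bool) (p : Fin n → Option Bool) : Prop :=
  ∀ x : Fin n → Bool, Consistent x p → f x = b

instance {n : ℕ} (f : (Fin n → Bool) → Bool) (b : Bool) (p : Fin n → Option Bool) :
    Decidable (IsCert f b p) := by unfold IsCert; infer_instance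

/-- The `b`-certificate complexity `C_b(f)`. -/
noncomputable def certC {n : ℕ} (f : (Fin n → Bool) → Bool) (b : Bool) : ℕ :=
  sInf {w : ℕ | ∀ x : Fin n → Bool, f x = b →
    ∃ p : Fin n → Option Bool, IsCert f b p ∧ paWidth p ≤ w ∧ Consistent x p}

/-- The certificate complexity `C(f) = max{C_0(f), C_1(f)}`. -/
noncomputable def certCC {n : ℕ} (f : (Fin n → Bool) → Bool) : ℕ :=
  max (certC f false) (certC f true)

/-- The unambiguous `b`-certificate complexity `UC_b(f)`. -/
noncomputable def UCb {n : ℕ} (f : (Fin n → Bool) → Bool) (b : Bool) : ℕ :=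
  sInf {w : ℕ | ∃ S : Set (Fin n → Option Bool),
    (∀ p ∈ S, IsCert f b p ∧ paWidth p ≤ w) ∧
    ∀ x : Fin n → Bool, f x = b → ∃! p, p ∈ S ∧ Consistent x p}

/-- Subcube partition complexity `UC(f) = max{UC_0(f), UC_1(f)}`. -/
noncomputable def UC {n : ℕ} (f : (Fin n → Bool) → Bool) : ℕ :=
  max (UCb f false) (UCb f true)

/-! ### Decision trees, deterministic and randomized query complexity -/

/-- Deterministic decision trees on `n` bits. -/
inductive DT (n : ℕ) where
  | leaf : Bool → DT n
  | node : Fin n → DT n → DT n → DT n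

/-- Evaluation of a decision tree on an input. -/
def DT.eval {n : ℕ} : DT n → (Fin n → Bool) → Bool
  | .leaf b, _ => b
  | .node i t0 t1, x => if x i then t1.eval x else t0.eval x

/-- Depth of a decision tree. -/
def DT.depth {n : ℕ} : DT n → ℕ
  | .leaf _ => 0
  | .node _ t0 t1 => 1 + max t0.depth t1.depth

/-- Deterministic query complexity `D(f)`. -/
noncomputable def Dquery {n : ℕ} (f : (Fin n → Bool) → Bool) : ℕ :=
  sInf {d : ℕ | ∃ T : DT n, T.depth ≤ d ∧ ∀ x, T.eval x = f x}

/-- Bounded-error randomized query complexity `R(f)`: minimum over finitely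
supported distributions over deterministic trees computing `f` with error `≤ 1/3`
of the maximum depth in the support. -/
noncomputable def Rquery {n : ℕ} (f : (Fin n → Bool) → Bool) : ℕ :=
  sInf {d : ℕ | ∃ ts : List (DT n × ℝ),
    (∀ p ∈ ts, 0 ≤ p.2 ∧ p.1.depth ≤ d) ∧
    (ts.map Prod.snd).sum = 1 ∧
    ∀ x : Fin n → Bool,
      (2 : ℝ) / 3 ≤ ((ts.filter (fun p => p.1.eval x == f x)).map Prod.snd).sum}

/-! ### Query trees over an arbitrary index type -/

/-- Decision trees whose queries are indexed by `ι`. -/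
inductive QT (ι : Type) where
  | leaf : Bool → QT ι
  | node : ι → QT ι → QT ι → QT ι

namespace QT

variable {ι J : Type}

/-- Evaluation of a query tree. -/
def eval : QT ι → (ι → Bool) → Bool
  | leaf b, _ => b
  | node i t0 t1, x => if x i then t1.eval x else t0.eval x

/-- Depth of a query tree. -/
def depth : QT ι → ℕ
  | leaf _ => 0
  | node _ t0 t1 => 1 + max t0.depth t1.depth

/-- The number of queries to variables satisfying `P` on the path followed by `x`. -/
def cost (P : ι → Bool) : QT ι → (ι → Bool) → ℕ
  | leaf _, _ => 0
  | node i t0 t1, x => (if P i then 1 else 0) + if x i then t1.cost P x else t0.cost P x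

/-- The value of a query tree as a real number. -/
def val (T : QT ι) (x : ι → Bool) : ℝ := if T.eval x then 1 else 0

/-- The tree that accepts exactly when `T` queries a variable satisfying `P`. -/
def hit (P : ι → Bool) : QT ι → QT ι
  | leaf _ => leaf false
  | node i t0 t1 => if P i then leaf true else node i (t0.hit P) (t1.hit P)

/-- Simulate a tree, replacing each query by a query to another index type or by a constant.
Once more than `d` queries are needed, the simulation stops and outputs `b`. -/
def sim (φ : ι → J ⊕ Bool) (b : Bool) : QT ι → ℕ → QT J
  | leaf c, _ => leaf c
  | node v t0 t1, d => match φ v, d with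
    | .inr c, d => if c then t1.sim φ b d else t0.sim φ b d
    | .inl _, 0 => leaf b
    | .inl j, d + 1 => node j (t0.sim φ b d) (t1.sim φ b d)

/-- The input seen by a simulated tree. -/
def simInput (φ : ι → J ⊕ Bool) (z : J → Bool) (v : ι) : Bool := Sum.elim z id (φ v)

theorem depth_sim_le (φ : ι → J ⊕ Bool) (b : Bool) (T : QT ι) (d : ℕ) :
    (T.sim φ b d).depth ≤ d := by
  induction T generalizing d with
  | leaf c => simp [sim, depth]
  | node v t0 t1 h0 h1 =>
    rcases h : φ v with j | c
    · cases d with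
      | zero => simp [sim, h, depth]
      | succ d =>
        simp only [sim, h, depth]
        have := h0 d
        have := h1 d
        omega
    · cases c <;> simp [sim, h, h0, h1]

theorem eval_sim (φ : ι → J ⊕ Bool) (b : Bool) (T : QT ι) (d : ℕ) (z : J → Bool) :
    (T.sim φ b d).eval z =
      if T.cost (fun v => (φ v).isLeft) (simInput φ z) ≤ d then T.eval (simInput φ z) else b := by
  induction T generalizing d with
  | leaf c => simp [sim, eval, cost]
  | node v t0 t1 h0 h1 =>
    rcases h : φ v with j | c
    · cases d with
      | zero => simp [sim, h, cost, eval]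
      | succ d =>
        have hv : simInput φ z v = z j := by simp [simInput, h]
        cases hz : z j <;> simp [sim, h, eval, cost, h0, h1, hv, hz, Nat.add_comm 1]
    · have hv : simInput φ z v = c := by simp [simInput, h]
      cases c <;> simp [sim, h, eval, cost, h0, h1, hv]

theorem cost_le_depth (P : ι → Bool) (T : QT ι) (x : ι → Bool) : T.cost P x ≤ T.depth := by
  induction T with
  | leaf c => simp [cost]
  | node v t0 t1 h0 h1 =>
    simp only [cost, depth]
    split_ifs <;> omega

theorem depth_hit_le (P : ι → Bool) (T : QT ι) : (T.hit P).depth ≤ T.depth := by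
  induction T with
  | leaf c => simp [hit, depth]
  | node v t0 t1 h0 h1 =>
    simp only [hit]
    split_ifs <;> simp only [depth] <;> omega

theorem eval_hit (P : ι → Bool) (T : QT ι) (x : ι → Bool) :
    (T.hit P).eval x = decide (0 < T.cost P x) := by
  induction T with
  | leaf c => simp [hit, eval, cost]
  | node v t0 t1 h0 h1 =>
    by_cases hP : P v
    · simp [hit, hP, eval, cost]
    · cases hx : x v <;> simp [hit, hP, eval, cost, hx, h0, h1]

theorem eval_eq_of_cost_eq_zero (P : ι → Bool) (T : QT ι) (x y : ι → Bool)
    (hxy : ∀ i, P i = false → y i = x i) (h : T.cost P x = 0) : T.eval y = T.eval x := by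
  induction T with
  | leaf c => rfl
  | node v t0 t1 h0 h1 =>
    by_cases hP : P v
    · simp [cost, hP] at h
    · have hv := hxy v (by simpa using hP)
      cases hx : x v <;> simp_all [cost, eval]

/-- Queries to disjoint classes of variables add up to at most the depth. -/
theorem sum_cost_le {β : Type} [Fintype β] (P : β → ι → Bool)
    (hP : ∀ b b' i, P b i = true → P b' i = true → b = b') (T : QT ι) (x : ι → Bool) :
    ∑ b, T.cost (P b) x ≤ T.depth := by
  induction T with
  | leaf c => simp [cost]
  | node v t0 t1 h0 h1 =>
    have hc : ∑ b, (if P b v = true then 1 else 0) ≤ 1 := by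
      rw [← Finset.card_filter, Finset.card_le_one]
      intro a ha b hb
      simp only [Finset.mem_filter] at ha hb
      exact hP a b v ha.2 hb.2
    simp only [cost, depth, Finset.sum_add_distrib]
    split_ifs <;> omega

theorem val_nonneg (T : QT ι) (x : ι → Bool) : 0 ≤ T.val x := by
  unfold val; split_ifs <;> norm_num

theorem val_le_one (T : QT ι) (x : ι → Bool) : T.val x ≤ 1 := by
  unfold val; split_ifs <;> norm_num

end QT

/-! ### Hard pairs of input distributions -/

/-- There are coupled uniform distributions on the `1`-inputs and `0`-inputs of `f` which no tree
of depth less than `D` distinguishes with advantage more than `δ`. -/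
def Hard {ι : Type} (f : (ι → Bool) → Bool) (D δ : ℝ) : Prop :=
  ∃ (Ω : Type) (_ : Fintype Ω) (_ : Nonempty Ω) (X : Bool → Ω → ι → Bool),
    (∀ b ω, f (X b ω) = b) ∧
    ∀ T : QT ι, (T.depth : ℝ) < D →
      |∑ ω, (T.val (X true ω) - T.val (X false ω))| ≤ δ * Fintype.card Ω

/-- The negation of a Boolean function. -/
def neg {ι : Type} (f : (ι → Bool) → Bool) (x : ι → Bool) : Bool := !f x

/-- The `i`-th block of an input indexed by a product. -/
def blk {κ J : Type} (x : κ × J → Bool) (i : κ) (j : J) : Bool := x (i, j)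

/-- The conjunction of `n` independent copies of `g`. -/
def andC {J : Type} (n : ℕ) (g : (J → Bool) → Bool) (x : Fin n × J → Bool) : Bool :=
  decide (∀ i, g (blk x i) = true)

theorem Hard.neg {ι : Type} {f : (ι → Bool) → Bool} {D δ : ℝ} (h : Hard f D δ) :
    Hard (neg f) D δ := by
  obtain ⟨Ω, i1, i2, X, hX, hT⟩ := h
  refine ⟨Ω, i1, i2, fun b => X (!b), fun b ω => by simp [_root_.neg, hX], fun T hd => ?_⟩
  have := hT T hd
  rw [← abs_neg, ← Finset.sum_neg_distrib]
  simpa using this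

theorem sum_update {κ Ω : Type} [Fintype κ] [DecidableEq κ] [Fintype Ω] (i : κ)
    (F : (κ → Ω) → ℝ) :
    ∑ ω : κ → Ω, ∑ z, F (Function.update ω i z) = Fintype.card Ω * ∑ ω, F ω := by
  have hinv : Function.Involutive
      (fun p : (κ → Ω) × Ω => (Function.update p.1 i p.2, p.1 i)) := by
    intro p; simp
  rw [← Fintype.sum_prod_type' (fun ω z => F (Function.update ω i z))]
  have := Equiv.sum_comp hinv.toPerm (fun p : (κ → Ω) × Ω => F p.1)
  simp only [Function.Involutive.coe_toPerm] at this
  rw [this, Fintype.sum_prod_type]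
  simp [Finset.mul_sum]

/-- The product input whose `k`-th block is drawn from the distribution `X (c k)`. -/
def prodInput {κ J Ω : Type} (X : Bool → Ω → J → Bool) (c : κ → Bool) (ω : κ → Ω) :
    κ × J → Bool := fun p => X (c p.1) (ω p.1) p.2

theorem blk_prodInput {κ J Ω : Type} (X : Bool → Ω → J → Bool) (c : κ → Bool) (ω : κ → Ω)
    (i : κ) : blk (prodInput X c ω) i = X (c i) (ω i) := rfl

/-- Changing the distribution of a single block is noticed with small advantage, up to the
probability that the tree makes many queries in that block. -/
theorem abs_sum_update_block_le {κ J Ω : Type} [Fintype κ] [DecidableEq κ] [Fintype Ω]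
    [Nonempty Ω] {X : Bool → Ω → J → Bool} {D δ : ℝ} (hD : 0 < D)
    (hX : ∀ T : QT J, (T.depth : ℝ) < D →
      |∑ ω, (T.val (X true ω) - T.val (X false ω))| ≤ δ * Fintype.card Ω)
    (T : QT (κ × J)) (c : κ → Bool) (i : κ) :
    |∑ ω, (T.val (prodInput X (Function.update c i true) ω) -
        T.val (prodInput X (Function.update c i false) ω))| ≤
      δ * Fintype.card (κ → Ω) +
        ∑ ω, (if D ≤ (T.cost (fun p => decide (p.1 = i))
          (prodInput X (Function.update c i true) ω) : ℝ) then (1 : ℝ) else 0) := by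
  set Y : Bool → (κ → Ω) → κ × J → Bool := fun b => prodInput X (Function.update c i b) with hY
  set P : κ × J → Bool := fun p => decide (p.1 = i) with hP
  set exc : (κ → Ω) → ℝ := fun ω => if D ≤ (T.cost P (Y true ω) : ℝ) then 1 else 0 with hexc
  obtain ⟨d, hd, hdD⟩ : ∃ d : ℕ, (d : ℝ) < D ∧ D ≤ d + 1 := by
    obtain ⟨d, hd⟩ : ∃ d, ⌈D⌉₊ = d + 1 := Nat.exists_eq_succ_of_ne_zero (Nat.ceil_pos.2 hD).ne'
    refine ⟨d, Nat.lt_ceil.1 (by omega), ?_⟩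
    have := Nat.le_ceil D
    rw [hd] at this
    exact_mod_cast this
  have key : ∀ ω : κ → Ω,
      |∑ z, (T.val (Y true (Function.update ω i z)) - T.val (Y false (Function.update ω i z)))| ≤
        δ * Fintype.card Ω + ∑ z, exc (Function.update ω i z) := by
    intro ω
    let φ : κ × J → J ⊕ Bool := fun p => if p.1 = i then .inl p.2 else .inr (X (c p.1) (ω p.1) p.2)
    have hφP : (fun v => (φ v).isLeft) = P := by
      funext p
      by_cases h : p.1 = i <;> simp [φ, P, h]
    have hin : ∀ b z, QT.simInput φ (X b z) = Y b (Function.update ω i z) := by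
      intro b z
      funext p
      obtain ⟨k, j⟩ := p
      by_cases h : k = i
      · subst h; simp [φ, QT.simInput, Y, prodInput]
      · simp [φ, QT.simInput, Y, prodInput, h]
    have hev : ∀ a b z, ((T.sim φ a d).eval (X b z)) =
        if T.cost P (Y b (Function.update ω i z)) ≤ d
          then T.eval (Y b (Function.update ω i z)) else a := by
      intro a b z
      rw [QT.eval_sim, hφP, hin]
    have hA : ∀ a, |∑ z, ((T.sim φ a d).val (X true z) - (T.sim φ a d).val (X false z))| ≤
        δ * Fintype.card Ω := by
      intro a
      refine hX _ (lt_of_le_of_lt ?_ hd)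
      exact_mod_cast QT.depth_sim_le φ a T d
    have hlow : ∀ b z, (T.sim φ false d).val (X b z) ≤ T.val (Y b (Function.update ω i z)) := by
      intro b z
      unfold QT.val
      rw [hev]
      split_ifs <;> simp_all
    have hupp : ∀ b z, T.val (Y b (Function.update ω i z)) ≤ (T.sim φ true d).val (X b z) := by
      intro b z
      unfold QT.val
      rw [hev]
      split_ifs <;> simp_all
    have hgap : ∀ a z, |(T.sim φ a d).val (X true z) - T.val (Y true (Function.update ω i z))| ≤
        exc (Function.update ω i z) := by
      intro a z
      by_cases hc : T.cost P (Y true (Function.update ω i z)) ≤ d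
      · have : (T.sim φ a d).val (X true z) = T.val (Y true (Function.update ω i z)) := by
          unfold QT.val
          rw [hev, if_pos hc]
        rw [this, sub_self, abs_zero]
        simp only [hexc]
        split_ifs <;> norm_num
      · have : exc (Function.update ω i z) = 1 := by
          simp only [hexc]
          rw [if_pos]
          have : d + 1 ≤ T.cost P (Y true (Function.update ω i z)) := by omega
          have : ((d + 1 : ℕ) : ℝ) ≤ T.cost P (Y true (Function.update ω i z)) := by
            exact_mod_cast this
          push_cast at this
          linarith
        rw [this, abs_le]
        have h1 := QT.val_nonneg (T.sim φ a d) (X true z)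
        have h2 := QT.val_le_one (T.sim φ a d) (X true z)
        have h3 := QT.val_nonneg T (Y true (Function.update ω i z))
        have h4 := QT.val_le_one T (Y true (Function.update ω i z))
        constructor <;> linarith
    rw [abs_le]
    constructor
    · have h1 : ∑ z, ((T.sim φ true d).val (X true z) - (T.sim φ true d).val (X false z) -
          exc (Function.update ω i z)) ≤
          ∑ z, (T.val (Y true (Function.update ω i z)) -
            T.val (Y false (Function.update ω i z))) :=
        Finset.sum_le_sum fun z _ => by
          have := hupp false z
          have := (abs_le.1 (hgap true z)).2
          linarith
      rw [Finset.sum_sub_distrib] at h1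
      have := (abs_le.1 (hA true)).1
      linarith
    · have h1 : ∑ z, (T.val (Y true (Function.update ω i z)) -
            T.val (Y false (Function.update ω i z))) ≤
          ∑ z, ((T.sim φ false d).val (X true z) - (T.sim φ false d).val (X false z) +
          exc (Function.update ω i z)) :=
        Finset.sum_le_sum fun z _ => by
          have := hlow false z
          have := (abs_le.1 (hgap false z)).1
          linarith
      rw [Finset.sum_add_distrib] at h1
      have := (abs_le.1 (hA false)).2
      linarith
  have hcard : (0 : ℝ) < Fintype.card Ω := by exact_mod_cast Fintype.card_pos
  have hsum := sum_update i (fun ω => T.val (Y true ω) - T.val (Y false ω))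
  have hsum' := sum_update i exc
  refine le_of_mul_le_mul_left ?_ hcard
  rw [← abs_of_pos hcard, ← abs_mul, abs_of_pos hcard, ← hsum, mul_add, ← hsum']
  refine (Finset.abs_sum_le_sum_abs _ _).trans ((Finset.sum_le_sum fun ω _ => key ω).trans ?_)
  rw [Finset.sum_add_distrib, Finset.sum_const, Finset.card_univ, nsmul_eq_mul]
  apply le_of_eq
  ring

theorem Hard.andC {J : Type} {g : (J → Bool) → Bool} {D δ : ℝ} (hD : 0 < D) (h : Hard g D δ)
    {n : ℕ} (hn : 0 < n) (q : ℝ) : Hard (andC n g) (n * D / q) (δ + 1 / q) := by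
  obtain ⟨Ω, i1, i2, X, hX, hT⟩ := h
  have : Nonempty (Fin n) := ⟨⟨0, hn⟩⟩
  let c : Bool → Fin n → Fin n → Bool := fun b i => Function.update (fun _ => true) i b
  refine ⟨Fin n × (Fin n → Ω), inferInstance, inferInstance,
    fun b p => prodInput X (c b p.1) p.2, ?_, ?_⟩
  · rintro b ⟨i, ω⟩
    simp only [_root_.andC, blk_prodInput, hX]
    cases b
    · simp only [decide_eq_false_iff_not, not_forall]
      exact ⟨i, by simp [c]⟩
    · simp [c]
  · intro T hd
    have hone : ∀ i, c true i = fun _ => true := fun i => Function.update_eq_self i _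
    have hpt : ∀ ω, ∑ i : Fin n, (if D ≤ (T.cost (fun p => decide (p.1 = i))
        (prodInput X (fun _ => true) ω) : ℝ) then (1 : ℝ) else 0) ≤ n / q := by
      intro ω
      have h1 : ∑ i : Fin n, (if D ≤ (T.cost (fun p => decide (p.1 = i))
          (prodInput X (fun _ => true) ω) : ℝ) then (1 : ℝ) else 0) ≤
          ∑ i : Fin n, (T.cost (fun p => decide (p.1 = i))
          (prodInput X (fun _ => true) ω) : ℝ) / D := by
        refine Finset.sum_le_sum fun i _ => ?_
        split_ifs with hi
        · rwa [le_div_iff₀ hD, one_mul]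
        · positivity
      have h2 := QT.sum_cost_le (fun (i : Fin n) (p : Fin n × J) => decide (p.1 = i))
        (by intro b b' p; simp; intro h h'; rw [← h, ← h']) T (prodInput X (fun _ => true) ω)
      have h3 : ∑ i : Fin n, (T.cost (fun p => decide (p.1 = i))
          (prodInput X (fun _ => true) ω) : ℝ) ≤ n * D / q := by
        refine le_trans ?_ hd.le
        exact_mod_cast h2
      rw [← Finset.sum_div] at h1
      refine h1.trans ?_
      rw [div_le_iff₀ hD]
      refine h3.trans (le_of_eq (by ring))
    rw [Fintype.sum_prod_type]
    refine (Finset.abs_sum_le_sum_abs _ _).trans ?_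
    refine (Finset.sum_le_sum fun i _ =>
      abs_sum_update_block_le hD hT T (fun _ => true) i).trans ?_
    rw [Finset.sum_add_distrib, Finset.sum_comm]
    have h4 : ∑ ω : Fin n → Ω, ∑ i : Fin n, (if D ≤ (T.cost (fun p => decide (p.1 = i))
        (prodInput X (Function.update (fun _ => true) i true) ω) : ℝ) then (1 : ℝ) else 0) ≤
        Fintype.card (Fin n → Ω) * (n / q) := by
      rw [← nsmul_eq_mul, ← Finset.card_univ]
      refine Finset.sum_le_card_nsmul _ _ _ fun ω _ => ?_
      simpa [Function.update_eq_self] using hpt ω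
    simp only [Finset.sum_const, Finset.card_univ, nsmul_eq_mul, Fintype.card_prod,
      Fintype.card_fin]
    push_cast at h4 ⊢
    refine (add_le_add_right h4 _).trans (le_of_eq (by ring))

/-! ### Certificates as sets of variables -/

/-- The values of `x` on `Q` determine the value of `f`. -/
def CertAt {ι : Type} (f : (ι → Bool) → Bool) (Q : Finset ι) (x : ι → Bool) : Prop :=
  ∀ y, (∀ i ∈ Q, y i = x i) → f y = f x

/-- Every `b`-input of `f` has a certificate of size at most `w b`. -/
def CCert {ι : Type} (f : (ι → Bool) → Bool) (w : Bool → ℕ) : Prop :=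
  ∃ U : (ι → Bool) → Finset ι, ∀ x, (U x).card ≤ w (f x) ∧ CertAt f (U x) x

/-- There is a subcube partition for `f` whose `b`-subcubes have codimension at most `w b`. -/
def UCert {ι : Type} (f : (ι → Bool) → Bool) (w : Bool → ℕ) : Prop :=
  ∃ U : (ι → Bool) → Finset ι, ∀ x, (U x).card ≤ w (f x) ∧
    ∀ y, (∀ i ∈ U x, y i = x i) → f y = f x ∧ U y = U x

theorem CertAt.mono {ι : Type} {f : (ι → Bool) → Bool} {Q Q' : Finset ι} {x : ι → Bool}
    (h : CertAt f Q x) (hQ : Q ⊆ Q') : CertAt f Q' x :=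
  fun y hy => h y fun i hi => hy i (hQ hi)

/-- Certificates depend only on the certified values. -/
theorem certAt_congr {ι : Type} {f : (ι → Bool) → Bool} {Q : Finset ι} {x y : ι → Bool}
    (hy : ∀ i ∈ Q, y i = x i) (hf : f y = f x) : CertAt f Q y ↔ CertAt f Q x := by
  unfold CertAt
  rw [hf]
  refine forall_congr' fun z => imp_congr_left (forall₂_congr fun i hi => ?_)
  rw [hy i hi]

theorem CCert.mono {ι : Type} {f : (ι → Bool) → Bool} {w w' : Bool → ℕ} (h : CCert f w)
    (hw : ∀ b, w b ≤ w' b) : CCert f w' := by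
  obtain ⟨U, hU⟩ := h
  exact ⟨U, fun x => ⟨(hU x).1.trans (hw _), (hU x).2⟩⟩

theorem UCert.mono {ι : Type} {f : (ι → Bool) → Bool} {w w' : Bool → ℕ} (h : UCert f w)
    (hw : ∀ b, w b ≤ w' b) : UCert f w' := by
  obtain ⟨U, hU⟩ := h
  exact ⟨U, fun x => ⟨(hU x).1.trans (hw _), (hU x).2⟩⟩

theorem CCert.min_card {ι : Type} [Fintype ι] {f : (ι → Bool) → Bool} {w : ℕ}
    (h : CCert f fun _ => w) : CCert f fun _ => min w (Fintype.card ι) := by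
  obtain ⟨U, hU⟩ := h
  exact ⟨U, fun x => ⟨le_min (hU x).1 (Finset.card_le_univ _), (hU x).2⟩⟩

theorem CCert.neg {ι : Type} {f : (ι → Bool) → Bool} {w : Bool → ℕ} (h : CCert f w) :
    CCert (neg f) fun b => w !b := by
  obtain ⟨U, hU⟩ := h
  refine ⟨U, fun x => ⟨by simpa [_root_.neg] using (hU x).1, fun y hy => ?_⟩⟩
  simp only [_root_.neg, (hU x).2 y hy]

theorem UCert.neg {ι : Type} {f : (ι → Bool) → Bool} {w : Bool → ℕ} (h : UCert f w) :
    UCert (neg f) fun b => w !b := by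
  obtain ⟨U, hU⟩ := h
  refine ⟨U, fun x => ⟨by simpa [_root_.neg] using (hU x).1, fun y hy => ?_⟩⟩
  simpa only [_root_.neg, ((hU x).2 y hy).1, true_and] using ((hU x).2 y hy).2

open Classical in
/-- The variables `(i, j)` with `j ∈ V i`. -/
noncomputable def blockSet {κ J : Type} [Fintype κ] (V : κ → Finset J) : Finset (κ × J) :=
  Finset.univ.biUnion fun i => (V i).image (Prod.mk i)

theorem mem_blockSet {κ J : Type} [Fintype κ] {V : κ → Finset J} {i : κ} {j : J} :
    (i, j) ∈ blockSet V ↔ j ∈ V i := by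
  simp [blockSet]

theorem card_blockSet_le {κ J : Type} [Fintype κ] (V : κ → Finset J) :
    (blockSet V).card ≤ ∑ i, (V i).card := by
  classical
  exact Finset.card_biUnion_le.trans (Finset.sum_le_sum fun _ _ => Finset.card_image_le)

theorem CCert.andC {J : Type} {g : (J → Bool) → Bool} {w : Bool → ℕ} (h : CCert g w) (n : ℕ) :
    CCert (andC n g) fun b => if b then n * w true else w false := by
  classical
  obtain ⟨U, hU⟩ := h
  have hx : ∀ x : Fin n × J → Bool, ∃ Q : Finset (Fin n × J),
      Q.card ≤ (if _root_.andC n g x then n * w true else w false) ∧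
        CertAt (_root_.andC n g) Q x := by
    intro x
    by_cases hg : ∀ i, g (blk x i) = true
    · have hgx : _root_.andC n g x = true := by simpa [_root_.andC] using hg
      refine ⟨blockSet fun i => U (blk x i), ?_, fun y hy => ?_⟩
      · rw [hgx, if_pos rfl]
        refine (card_blockSet_le _).trans ?_
        refine (Finset.sum_le_card_nsmul _ _ (w true) fun i _ => ?_).trans (by simp)
        simpa [hg i] using (hU (blk x i)).1
      · rw [hgx]
        simp only [_root_.andC, decide_eq_true_eq]
        intro i
        rw [(hU (blk x i)).2 (blk y i) fun j hj => hy (i, j) (mem_blockSet.2 hj), hg i]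
    · have hgx : _root_.andC n g x = false := by simpa [_root_.andC] using hg
      obtain ⟨i, hi⟩ := not_forall.1 hg
      refine ⟨(U (blk x i)).image (Prod.mk i), ?_, fun y hy => ?_⟩
      · rw [hgx]
        refine Finset.card_image_le.trans ?_
        simpa [hi] using (hU (blk x i)).1
      · rw [hgx]
        simp only [_root_.andC, decide_eq_false_iff_not, not_forall]
        refine ⟨i, ?_⟩
        rwa [(hU (blk x i)).2 (blk y i) fun j hj => hy (i, j) (Finset.mem_image_of_mem _ hj)]
  choose Q hQ using hx
  exact ⟨Q, hQ⟩

theorem UCert.andC {J : Type} {g : (J → Bool) → Bool} {w : Bool → ℕ} (h : UCert g w) (n : ℕ) :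
    UCert (andC n g) fun b => if b then n * w true else n * w true + w false := by
  classical
  obtain ⟨U, hU⟩ := h
  let V : (Fin n × J → Bool) → Fin n → Finset J := fun x i =>
    if ∀ i' < i, g (blk x i') = true then U (blk x i) else ∅
  refine ⟨fun x => blockSet (V x), fun x => ⟨?_, fun y hy => ?_⟩⟩
  · refine (card_blockSet_le _).trans ?_
    set F : Finset (Fin n) := Finset.univ.filter fun i =>
      (∀ i' < i, g (blk x i') = true) ∧ g (blk x i) = false with hF
    have h1 : ∀ i, (V x i).card ≤ w true + if i ∈ F then w false else 0 := by
      intro i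
      have hc := (hU (blk x i)).1
      by_cases hp : ∀ i' < i, g (blk x i') = true
      · simp only [V, if_pos hp]
        cases hg : g (blk x i)
        · have hi : i ∈ F := by
            rw [hF, Finset.mem_filter]
            exact ⟨Finset.mem_univ i, hp, hg⟩
          rw [if_pos hi]
          rw [hg] at hc
          exact hc.trans (Nat.le_add_left _ _)
        · rw [hg] at hc
          exact hc.trans (Nat.le_add_right _ _)
      · simp only [V, if_neg hp, Finset.card_empty, Nat.zero_le]
    have h2 : F.card ≤ 1 := by
      rw [Finset.card_le_one]
      intro a ha b hb
      simp only [hF, Finset.mem_filter] at ha hb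
      rcases lt_trichotomy a b with hab | hab | hab
      · exact absurd (hb.2.1 a hab) (by simp [ha.2.2])
      · exact hab
      · exact absurd (ha.2.1 b hab) (by simp [hb.2.2])
    refine (Finset.sum_le_sum fun i _ => h1 i).trans ?_
    rw [Finset.sum_add_distrib, ← Finset.sum_filter, Finset.sum_const, Finset.sum_const]
    simp only [Finset.card_univ, Fintype.card_fin, smul_eq_mul, Finset.filter_univ_mem]
    by_cases hg : ∀ i, g (blk x i) = true
    · have hF0 : F = ∅ := by simp [hF, hg]
      simp [_root_.andC, hg, hF0]
    · have : F.card * w false ≤ 1 * w false := Nat.mul_le_mul_right _ h2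
      simp only [_root_.andC, hg, decide_false]
      simpa using this
  · have hyV : ∀ i, ∀ j ∈ V x i, blk y i j = blk x i j :=
      fun i j hj => hy (i, j) (mem_blockSet.2 hj)
    have hstep : ∀ i, (∀ i' < i, g (blk x i') = true) →
        g (blk y i) = g (blk x i) ∧ U (blk y i) = U (blk x i) := by
      intro i hi
      refine (hU (blk x i)).2 _ fun j hj => hyV i j ?_
      simpa only [V, if_pos hi] using hj
    have hpre : ∀ i : Fin n, (∀ i' < i, g (blk y i') = true) ↔ ∀ i' < i, g (blk x i') = true := by
      intro i
      constructor
      · intro hi i'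
        induction i' using WellFoundedLT.induction with
        | ind k ih =>
          intro hk
          rw [← (hstep k fun i' hi' => ih i' hi' (hi'.trans hk)).1]
          exact hi k hk
      · intro hi i' hi'
        rw [(hstep i' fun k hk => hi k (hk.trans hi')).1]
        exact hi i' hi'
    refine ⟨?_, ?_⟩
    · simp only [_root_.andC, decide_eq_decide]
      constructor
      · intro hg i
        have := (hpre i).1 fun i' _ => hg i'
        rw [← (hstep i this).1]
        exact hg i
      · intro hg i
        rw [(hstep i fun i' _ => hg i').1]
        exact hg i
    · refine congrArg blockSet (funext fun i => ?_)
      simp only [V, hpre i]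
      split_ifs with hi
      · exact (hstep i hi).2
      · rfl

/-! ### The cheat sheet construction -/

/-- Variables of a cheat sheet function: `t` inputs of the base function, and for each address in
`{0,1}^t` a cell consisting of a flag and, for each input, `w` pointers of `s` bits. -/
abbrev CSIdx (H : Type) (t w s : ℕ) : Type :=
  (Fin t × H) ⊕ ((Fin t → Bool) × Option (Fin t × Fin w × Fin s))

section CheatSheet

variable {H : Type} {t w s : ℕ} (h : (H → Bool) → Bool) (dec : (Fin s → Bool) → H)

/-- The input of the `i`-th copy of the base function. -/
def csBlk (x : CSIdx H t w s → Bool) (i : Fin t) : H → Bool := blk (fun p => x (.inl p)) i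

/-- The address computed by the copies of the base function. -/
def csAddr (x : CSIdx H t w s → Bool) (i : Fin t) : Bool := h (csBlk x i)

open Classical in
/-- The variables of the `i`-th copy listed in the cell at address `a`. -/
noncomputable def csQuery (x : CSIdx H t w s → Bool) (a : Fin t → Bool) (i : Fin t) : Finset H :=
  Finset.univ.image fun j : Fin w => dec fun k => x (.inr (a, some (i, j, k)))

open Classical in
/-- The cheat sheet function accepts if the cell at the computed address is flagged and lists
certificates for all copies. -/
noncomputable def cheatSheet (x : CSIdx H t w s → Bool) : Bool :=
  decide (x (.inr (csAddr h x, none)) = true ∧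
    ∀ i, CertAt h (csQuery dec x (csAddr h x) i) (csBlk x i))

open Classical in
/-- The variables of the addressed cell, the variables listed there, and for `0`-inputs also the
certificates `V` of the copies. -/
noncomputable def csCert (V : (H → Bool) → Finset H) (x : CSIdx H t w s → Bool) :
    Finset (CSIdx H t w s) :=
  (blockSet fun i => csQuery dec x (csAddr h x) i ∪
    if cheatSheet h dec x then ∅ else V (csBlk x i)).disjSum
  (Finset.univ.image (Prod.mk (csAddr h x)))

theorem card_csCert_le {V : (H → Bool) → Finset H} {v : ℕ} (hV : ∀ z, (V z).card ≤ v)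
    (x : CSIdx H t w s → Bool) :
    (csCert h dec V x).card ≤
      t * (w + if cheatSheet h dec x then 0 else v) + (t * (w * s) + 1) := by
  classical
  rw [csCert, Finset.card_disjSum]
  refine add_le_add ((card_blockSet_le _).trans ?_) ?_
  · refine (Finset.sum_le_card_nsmul _ _ (w + if cheatSheet h dec x then 0 else v)
      fun i _ => ?_).trans (by simp)
    refine (Finset.card_union_le _ _).trans (add_le_add ?_ ?_)
    · exact Finset.card_image_le.trans (by simp)
    · split_ifs
      · simp
      · exact hV _
  · exact Finset.card_image_le.trans (by simp)

theorem csCert_spec {V : (H → Bool) → Finset H} (hV : ∀ z, CertAt h (V z) z)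
    (x y : CSIdx H t w s → Bool) (hy : ∀ i ∈ csCert h dec V x, y i = x i) :
    csAddr h y = csAddr h x ∧ csQuery dec y (csAddr h x) = csQuery dec x (csAddr h x) ∧
      cheatSheet h dec y = cheatSheet h dec x ∧
      (cheatSheet h dec x = false → ∀ i, ∀ j ∈ V (csBlk x i), csBlk y i j = csBlk x i j) := by
  classical
  have hcell : ∀ o, y (.inr (csAddr h x, o)) = x (.inr (csAddr h x, o)) := fun o =>
    hy _ (by simp [csCert])
  have hq : csQuery dec y (csAddr h x) = csQuery dec x (csAddr h x) := by
    funext i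
    simp only [csQuery, hcell]
  have hQ : ∀ i, ∀ j ∈ csQuery dec x (csAddr h x) i, csBlk y i j = csBlk x i j := by
    intro i j hj
    refine hy _ ?_
    simp only [csCert, Finset.inl_mem_disjSum, mem_blockSet, Finset.mem_union]
    exact Or.inl hj
  have hW : cheatSheet h dec x = false → ∀ i, ∀ j ∈ V (csBlk x i), csBlk y i j = csBlk x i j := by
    intro hx i j hj
    refine hy _ ?_
    simp only [csCert, Finset.inl_mem_disjSum, mem_blockSet, Finset.mem_union, hx]
    exact Or.inr (by simpa using hj)
  have ha : csAddr h y = csAddr h x := by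
    funext i
    rcases hx : cheatSheet h dec x with _ | _
    · exact hV _ _ (hW hx i)
    · simp only [cheatSheet, decide_eq_true_eq] at hx
      exact hx.2 i _ (hQ i)
  refine ⟨ha, hq, ?_, hW⟩
  simp only [cheatSheet, ha, hq, hcell, decide_eq_decide]
  refine and_congr_right fun _ => forall_congr' fun i => ?_
  exact certAt_congr (hQ i) (congrFun ha i)

variable {h}

theorem CCert.cheatSheet {v : ℕ} (hC : CCert h fun _ => v) :
    CCert (cheatSheet (t := t) (w := w) h dec) fun _ => t * (w + v) + (t * (w * s) + 1) := by
  obtain ⟨V, hV⟩ := hC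
  refine ⟨csCert h dec V, fun x => ⟨(card_csCert_le h dec (fun z => (hV z).1) x).trans ?_,
    fun y hy => (csCert_spec h dec (fun z => (hV z).2) x y hy).2.2.1⟩⟩
  refine Nat.add_le_add_right (Nat.mul_le_mul_left _ (Nat.add_le_add_left ?_ _)) _
  split_ifs <;> simp

theorem UCert.cheatSheet {v : ℕ} (hC : UCert h fun _ => v) :
    UCert (cheatSheet (t := t) (w := w) h dec)
      fun b => t * (w + if b then 0 else v) + (t * (w * s) + 1) := by
  obtain ⟨V, hV⟩ := hC
  refine ⟨csCert h dec V, fun x => ⟨card_csCert_le h dec (fun z => (hV z).1) x, fun y hy => ?_⟩⟩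
  obtain ⟨ha, hq, hc, hW⟩ := csCert_spec h dec (fun z y hy => ((hV z).2 y hy).1) x y hy
  refine ⟨hc, ?_⟩
  unfold csCert
  rw [ha, hc, hq]
  congr 2
  funext i
  congr 1
  split_ifs with hx
  · rfl
  · exact ((hV _).2 _ (hW (by simpa using hx) i)).2

end CheatSheet

/-- Trees of small depth accept the product distributions with nearly equal probabilities. -/
theorem abs_sum_prodInput_sub_le {κ J Ω : Type} [Fintype κ] [DecidableEq κ] [Fintype Ω]
    [Nonempty Ω] {X : Bool → Ω → J → Bool} {D δ : ℝ} (hD : 0 < D)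
    (hX : ∀ T : QT J, (T.depth : ℝ) < D →
      |∑ ω, (T.val (X true ω) - T.val (X false ω))| ≤ δ * Fintype.card Ω)
    (T : QT (κ × J)) (hT : (T.depth : ℝ) < D) (c c' : κ → Bool) :
    |∑ ω, T.val (prodInput X c ω) - ∑ ω, T.val (prodInput X c' ω)| ≤
      Fintype.card κ * (δ * Fintype.card (κ → Ω)) := by
  have hδ : 0 ≤ δ := by
    have h1 := (abs_nonneg _).trans (hX (.leaf false) (by simpa [QT.depth] using hD))
    have h2 : (0 : ℝ) < Fintype.card Ω := by exact_mod_cast Fintype.card_pos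
    exact nonneg_of_mul_nonneg_left h1 h2
  have hB : 0 ≤ δ * Fintype.card (κ → Ω) := by positivity
  have hstep : ∀ (p : κ → Bool) (i : κ),
      |∑ ω, T.val (prodInput X (Function.update p i true) ω) -
        ∑ ω, T.val (prodInput X (Function.update p i false) ω)| ≤ δ * Fintype.card (κ → Ω) := by
    intro p i
    have := abs_sum_update_block_le hD hX T p i
    rw [Finset.sum_sub_distrib] at this
    refine this.trans (le_of_eq ?_)
    rw [add_eq_left]
    refine Finset.sum_eq_zero fun ω _ => if_neg (not_le.2 (lt_of_le_of_lt ?_ hT))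
    exact_mod_cast QT.cost_le_depth _ _ _
  have hstep' : ∀ (p : κ → Bool) (i : κ) (b b' : Bool),
      |∑ ω, T.val (prodInput X (Function.update p i b) ω) -
        ∑ ω, T.val (prodInput X (Function.update p i b') ω)| ≤ δ * Fintype.card (κ → Ω) := by
    intro p i b b'
    cases b <;> cases b'
    · simpa using hB
    · rw [abs_sub_comm]; exact hstep p i
    · exact hstep p i
    · simpa using hB
  have hind : ∀ s : Finset κ, |∑ ω, T.val (prodInput X (s.piecewise c c') ω) -
      ∑ ω, T.val (prodInput X c' ω)| ≤ s.card * (δ * Fintype.card (κ → Ω)) := by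
    intro s
    induction s using Finset.induction_on with
    | empty => simp
    | insert i s hi ih =>
      rw [Finset.piecewise_insert, Finset.card_insert_of_notMem hi]
      have h1 := hstep' (s.piecewise c c') i (c i) (s.piecewise c c' i)
      rw [Function.update_eq_self] at h1
      push_cast
      linarith [abs_sub_le (∑ ω, T.val (prodInput X (Function.update (s.piecewise c c') i (c i)) ω))
        (∑ ω, T.val (prodInput X (s.piecewise c c') ω)) (∑ ω, T.val (prodInput X c' ω))]
  simpa using hind Finset.univ

/-- Small sets can be enumerated by `Fin w`. -/
theorem exists_subset_range {H : Type} [Nonempty H] {w : ℕ} (S : Finset H) (hS : S.card ≤ w) :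
    ∃ e : Fin w → H, ∀ j ∈ S, ∃ k, e k = j := by
  obtain ⟨f⟩ : Nonempty (S ↪ Fin w) := Function.Embedding.nonempty_of_card_le (by simpa using hS)
  refine ⟨Function.extend f Subtype.val fun _ => Classical.arbitrary H, fun j hj => ⟨f ⟨j, hj⟩, ?_⟩⟩
  rw [f.injective.extend_apply]

theorem Hard.cheatSheet {H : Type} {t w s : ℕ} {h : (H → Bool) → Bool}
    {dec : (Fin s → Bool) → H} (hdec : Function.Surjective dec) (hC : CCert h fun _ => w)
    {D δ q : ℝ} (hD : 0 < D) (hh : Hard h D δ) (hq : 0 < q) (hDq : q * D ≤ 2 ^ t) :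
    Hard (cheatSheet (t := t) (w := w) h dec) D (t * δ + 1 / q) := by
  classical
  obtain ⟨Ω, i1, i2, X, hX, hT⟩ := hh
  have : Nonempty H := ⟨dec fun _ => false⟩
  have hE : ∀ z, ∃ E : Fin w → Fin s → Bool, CertAt h (Finset.univ.image fun j => dec (E j)) z := by
    intro z
    obtain ⟨U, hU⟩ := hC
    obtain ⟨e, he⟩ := exists_subset_range (U z) (hU z).1
    choose E hE using fun j => hdec (e j)
    refine ⟨E, (hU z).2.mono fun j hj => ?_⟩
    obtain ⟨k, rfl⟩ := he j hj
    exact Finset.mem_image.2 ⟨k, Finset.mem_univ _, hE k⟩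
  choose E hE using hE
  let junk : (Fin t × H → Bool) → CSIdx H t w s → Bool := fun x => Sum.elim x fun _ => false
  let fill : (Fin t × H → Bool) → CSIdx H t w s → Bool := fun x => Sum.elim x fun v =>
    if v.1 = fun i => h (blk x i) then
      match v.2 with
      | none => true
      | some (i, j, k) => E (blk x i) j k
    else false
  refine ⟨(Fin t → Bool) × (Fin t → Ω), inferInstance, inferInstance,
    fun b p => if b then fill (prodInput X p.1 p.2) else junk (prodInput X p.1 p.2), ?_, ?_⟩
  · rintro b ⟨a, ω⟩
    cases b
    · simp [_root_.cheatSheet, junk]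
    · simp only [_root_.cheatSheet, if_true, decide_eq_true_eq]
      have hb : ∀ i, csBlk (fill (prodInput X a ω)) i = blk (prodInput X a ω) i := fun i => rfl
      have ha : csAddr h (fill (prodInput X a ω)) = fun i => h (blk (prodInput X a ω) i) := rfl
      rw [ha]
      refine ⟨by simp [fill], fun i => ?_⟩
      have hq : csQuery dec (fill (prodInput X a ω)) (fun i => h (blk (prodInput X a ω) i)) i =
          Finset.univ.image fun j => dec (E (blk (prodInput X a ω) i) j) := by
        simp [csQuery, fill]
      rw [hq, hb]
      exact hE _
  · intro T hTd
    let P : (Fin t → Bool) → CSIdx H t w s → Bool := fun a =>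
      Sum.elim (fun _ => false) fun v => decide (v.1 = a)
    let φ : CSIdx H t w s → (Fin t × H) ⊕ Bool := Sum.elim .inl fun _ => .inr false
    have hφ : ∀ x, QT.simInput φ x = junk x := by
      intro x
      funext v
      rcases v with v | v <;> simp [QT.simInput, φ, junk]
    let T' : (Fin t → Bool) → QT (Fin t × H) := fun a => (T.hit (P a)).sim φ false T.depth
    have hT'd : ∀ a, ((T' a).depth : ℝ) < D := by
      intro a
      refine lt_of_le_of_lt ?_ hTd
      exact_mod_cast QT.depth_sim_le _ _ _ _
    have hT'v : ∀ a x, (T' a).val x = if 0 < T.cost (P a) (junk x) then 1 else 0 := by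
      intro a x
      have hev : (T' a).eval x = decide (0 < T.cost (P a) (junk x)) := by
        rw [QT.eval_sim, if_pos ((QT.cost_le_depth _ _ _).trans (QT.depth_hit_le _ _)),
          QT.eval_hit, hφ]
      simp only [QT.val, hev, decide_eq_true_eq]
    have hdiff : ∀ a (ω : Fin t → Ω),
        |T.val (fill (prodInput X a ω)) - T.val (junk (prodInput X a ω))| ≤
          (T' a).val (prodInput X a ω) := by
      intro a ω
      rw [hT'v]
      split_ifs with hc
      · rw [abs_le]
        have h1 := QT.val_nonneg T (fill (prodInput X a ω))
        have h2 := QT.val_le_one T (fill (prodInput X a ω))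
        have h3 := QT.val_nonneg T (junk (prodInput X a ω))
        have h4 := QT.val_le_one T (junk (prodInput X a ω))
        constructor <;> linarith
      · have := QT.eval_eq_of_cost_eq_zero (P a) T (junk (prodInput X a ω))
          (fill (prodInput X a ω)) ?_ (by omega)
        · simp [QT.val, this]
        · rintro (v | v) hv
          · rfl
          · have hv' : v.1 ≠ a := by simpa [P] using hv
            have : (fun i => h (blk (prodInput X a ω) i)) = a := by
              funext i
              rw [blk_prodInput, hX]
            simp [fill, junk, this, hv']
    have hhit : ∀ a, ∑ ω, (T' a).val (prodInput X a ω) ≤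
        ∑ ω, (T' a).val (prodInput X (fun _ => false) ω) +
          t * (δ * Fintype.card (Fin t → Ω)) := by
      intro a
      have := (abs_le.1 (abs_sum_prodInput_sub_le hD hT (T' a) (hT'd a) a fun _ => false)).2
      rw [Fintype.card_fin] at this
      linarith
    have hdisj : ∀ x, ∑ a, (T' a).val x ≤ 2 ^ t / q := by
      intro x
      have h1 : ∑ a, (T' a).val x ≤ ∑ a, (T.cost (P a) (junk x) : ℝ) := by
        refine Finset.sum_le_sum fun a _ => ?_
        rw [hT'v]
        split_ifs with hc
        · exact_mod_cast hc
        · positivity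
      have h2 := QT.sum_cost_le P (by
        rintro b b' (v | v) <;> simp only [P, Sum.elim_inl, Sum.elim_inr, decide_eq_true_eq]
        · intro hf; cases hf
        · intro hb hb'; rw [← hb, ← hb']) T (junk x)
      have h3 : ∑ a, (T.cost (P a) (junk x) : ℝ) ≤ T.depth := by exact_mod_cast h2
      rw [le_div_iff₀ hq]
      nlinarith
    simp only [if_true, Bool.false_eq_true, if_false]
    refine (Finset.abs_sum_le_sum_abs _ _).trans ?_
    rw [Fintype.sum_prod_type]
    refine (Finset.sum_le_sum fun a _ => (Finset.sum_le_sum fun ω _ => hdiff a ω).trans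
      (hhit a)).trans ?_
    rw [Finset.sum_add_distrib, Finset.sum_comm]
    refine (add_le_add_left (Finset.sum_le_card_nsmul _ _ (2 ^ t / q) fun ω _ => hdisj _) _).trans ?_
    simp only [Finset.sum_const, Finset.card_univ, nsmul_eq_mul, Fintype.card_prod]
    have hc : (Fintype.card (Fin t → Bool) : ℝ) = 2 ^ t := by simp
    push_cast [hc]
    apply le_of_eq
    ring

/-! ### Transfer to the standard measures -/

theorem Hard.mono {ι : Type} {f : (ι → Bool) → Bool} {D δ δ' : ℝ} (h : Hard f D δ)
    (hδ : δ ≤ δ') : Hard f D δ' := by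
  obtain ⟨Ω, i1, i2, X, hX, hT⟩ := h
  exact ⟨Ω, i1, i2, X, hX, fun T hd => (hT T hd).trans (by gcongr)⟩

theorem Hard.exists_eq {ι : Type} {f : (ι → Bool) → Bool} {D δ : ℝ} (h : Hard f D δ) (b : Bool) :
    ∃ x, f x = b := by
  obtain ⟨Ω, _, ⟨ω⟩, X, hX, -⟩ := h
  exact ⟨X b ω, hX b ω⟩

theorem Hard.comp_equiv {ι J : Type} {f : (ι → Bool) → Bool} {D δ : ℝ} (h : Hard f D δ)
    (e : ι ≃ J) : Hard (fun y : J → Bool => f (y ∘ e)) D δ := by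
  obtain ⟨Ω, i1, i2, X, hX, hT⟩ := h
  refine ⟨Ω, i1, i2, fun b ω => X b ω ∘ e.symm, ?_, fun T hd => ?_⟩
  · intro b ω
    simp [Function.comp_assoc, hX]
  · let φ : J → ι ⊕ Bool := fun v => .inl (e.symm v)
    have hv : ∀ z : ι → Bool, T.val (z ∘ e.symm) = (T.sim φ false T.depth).val z := by
      intro z
      have hz : QT.simInput φ z = z ∘ e.symm := rfl
      simp only [QT.val]
      rw [QT.eval_sim, if_pos (QT.cost_le_depth _ _ _), hz]
    simp only [hv]
    refine hT _ (lt_of_le_of_lt ?_ hd)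
    exact_mod_cast QT.depth_sim_le _ _ _ _

theorem UCert.comp_equiv {ι J : Type} {f : (ι → Bool) → Bool} {w : Bool → ℕ} (h : UCert f w)
    (e : ι ≃ J) : UCert (fun y : J → Bool => f (y ∘ e)) w := by
  obtain ⟨U, hU⟩ := h
  refine ⟨fun y => (U (y ∘ e)).map e.toEmbedding, fun x => ⟨by simpa using (hU (x ∘ e)).1, ?_⟩⟩
  intro y hy
  obtain ⟨h1, h2⟩ := (hU (x ∘ e)).2 (y ∘ e) fun i hi =>
    hy (e i) (Finset.mem_map_of_mem e.toEmbedding hi)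
  exact ⟨h1, congrArg (Finset.map e.toEmbedding) h2⟩

/-- A subcube partition in the form used to define `UCb`. -/
theorem UCert.mem_widths {n : ℕ} {f : (Fin n → Bool) → Bool} {w : Bool → ℕ} (h : UCert f w)
    (b : Bool) : ∃ S : Set (Fin n → Option Bool), (∀ p ∈ S, IsCert f b p ∧ paWidth p ≤ w b) ∧
      ∀ x : Fin n → Bool, f x = b → ∃! p, p ∈ S ∧ Consistent x p := by
  obtain ⟨U, hU⟩ := h
  let p : (Fin n → Bool) → Fin n → Option Bool := fun x i => if i ∈ U x then some (x i) else none
  have hp : ∀ x y, Consistent y (p x) ↔ ∀ i ∈ U x, y i = x i := by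
    intro x y
    simp only [Consistent, p, Option.ite_none_right_eq_some, Option.some.injEq]
    exact ⟨fun h i hi => h i _ ⟨hi, rfl⟩, fun h i b hb => hb.2 ▸ h i hb.1⟩
  refine ⟨{r | ∃ x, f x = b ∧ r = p x}, ?_, ?_⟩
  · rintro _ ⟨x, rfl, rfl⟩
    refine ⟨fun y hy => ((hU x).2 y ((hp x y).1 hy)).1, le_of_eq_of_le ?_ (hU x).1⟩
    unfold paWidth
    congr 1
    ext i
    simp only [p, Finset.mem_filter, Finset.mem_univ, true_and]
    split_ifs with hi <;> simp [hi]
  · intro x hx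
    refine ⟨p x, ⟨⟨x, hx, rfl⟩, (hp x x).2 fun _ _ => rfl⟩, ?_⟩
    rintro _ ⟨⟨y, -, rfl⟩, hy⟩
    have hyx := (hp y x).1 hy
    have hUU := ((hU y).2 x hyx).2
    funext i
    simp only [p, hUU]
    split_ifs with hi
    · rw [hyx i hi]
    · rfl

theorem UCert.UC_le {n : ℕ} {f : (Fin n → Bool) → Bool} {u : ℕ} (h : UCert f fun _ => u) :
    UC f ≤ u :=
  max_le (Nat.sInf_le (h.mem_widths false)) (Nat.sInf_le (h.mem_widths true))

/-- If some `1`-input has only wide certificates, the subcube partition complexity is large. -/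
theorem UCert.le_UC {n u : ℕ} {f : (Fin n → Bool) → Bool} {w : Bool → ℕ} (h : UCert f w)
    (x : Fin n → Bool) (hx : f x = true)
    (hw : ∀ p, IsCert f true p → Consistent x p → u ≤ paWidth p) : u ≤ UC f := by
  refine le_trans ?_ (le_max_right _ _)
  obtain ⟨S, hS, hS'⟩ := Nat.sInf_mem (s := {w : ℕ | ∃ S : Set (Fin n → Option Bool),
    (∀ p ∈ S, IsCert f true p ∧ paWidth p ≤ w) ∧
    ∀ x : Fin n → Bool, f x = true → ∃! p, p ∈ S ∧ Consistent x p}) ⟨_, h.mem_widths true⟩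
  obtain ⟨p, ⟨hpS, hpx⟩, -⟩ := hS' x hx
  exact (hw p (hS p hpS).1 hpx).trans (hS p hpS).2

theorem le_paWidth_andC {J : Type} {g : (J → Bool) → Bool} {n N : ℕ} (e : Fin n × J ≃ Fin N)
    {z0 z1 : J → Bool} (h0 : g z0 = false) {p : Fin N → Option Bool}
    (hp : IsCert (fun y => andC n g (y ∘ e)) true p)
    (hx : Consistent (fun v => z1 (e.symm v).2) p) : n ≤ paWidth p := by
  have hj : ∀ i, ∃ j, (p (e (i, j))).isSome = true := by
    intro i
    by_contra! hcon
    have hc : Consistent (fun v => if (e.symm v).1 = i then z0 (e.symm v).2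
        else z1 (e.symm v).2) p := by
      intro v b hb
      have hv : (e.symm v).1 ≠ i := by
        rintro rfl
        have := hcon (e.symm v).2
        rw [Prod.mk.eta, Equiv.apply_symm_apply, hb] at this
        simp at this
      simpa only [if_neg hv] using hx v b hb
    have := hp _ hc
    simp only [andC, decide_eq_true_eq] at this
    have hi := this i
    have hb : blk ((fun v => if (e.symm v).1 = i then z0 (e.symm v).2
        else z1 (e.symm v).2) ∘ e) i = z0 := by
      funext j
      simp [blk]
    rw [hb, h0] at hi
    exact Bool.false_ne_true hi
  choose j hj using hj
  have hinj : Function.Injective fun i => e (i, j i) := by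
    intro a b hab
    exact congrArg Prod.fst (e.injective hab)
  have := Finset.card_le_card_of_injOn (s := Finset.univ)
    (t := Finset.univ.filter fun v => (p v).isSome = true) (fun i => e (i, j i))
    (fun i _ => by simpa using hj i) hinj.injOn
  simpa [paWidth] using this

/-- A decision tree as a query tree. -/
def QT.ofDT {n : ℕ} : DT n → QT (Fin n)
  | .leaf b => .leaf b
  | .node i t0 t1 => .node i (ofDT t0) (ofDT t1)

theorem QT.eval_ofDT {n : ℕ} (T : DT n) (x : Fin n → Bool) : (ofDT T).eval x = T.eval x := by
  induction T with
  | leaf b => rfl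
  | node i t0 t1 h0 h1 => simp only [ofDT, QT.eval, DT.eval, h0, h1]

theorem QT.depth_ofDT {n : ℕ} (T : DT n) : (ofDT T).depth = T.depth := by
  induction T with
  | leaf b => rfl
  | node i t0 t1 h0 h1 => simp only [ofDT, QT.depth, DT.depth, h0, h1]

theorem exists_DT_eval {n : ℕ} (f : (Fin n → Bool) → Bool) : ∃ T : DT n, ∀ x, T.eval x = f x := by
  have key : ∀ (s : Finset (Fin n)) (f : (Fin n → Bool) → Bool),
      (∀ x y, (∀ i ∈ s, x i = y i) → f x = f y) → ∃ T : DT n, ∀ x, T.eval x = f x := by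
    intro s
    induction s using Finset.induction_on with
    | empty => exact fun f hf => ⟨.leaf (f fun _ => false), fun x => hf _ _ (by simp)⟩
    | insert i s _ ih =>
      intro f hf
      have hb : ∀ b, ∃ T : DT n, ∀ x, T.eval x = f (Function.update x i b) := by
        intro b
        refine ih _ fun x y hxy => hf _ _ fun k hk => ?_
        by_cases hki : k = i
        · subst hki; simp
        · simpa [hki] using hxy k ((Finset.mem_insert.1 hk).resolve_left hki)
      choose T hT using hb
      refine ⟨.node i (T false) (T true), fun x => ?_⟩
      have hx : f (Function.update x i (x i)) = f x := by rw [Function.update_eq_self]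
      cases h : x i <;> rw [h] at hx <;> simp [DT.eval, h, hT, hx]
  exact key Finset.univ f fun x y hxy => by rw [funext fun i => hxy i (Finset.mem_univ i)]

theorem Hard.le_Rquery {n : ℕ} {f : (Fin n → Bool) → Bool} {D δ : ℝ} (h : Hard f D δ)
    (hδ : δ < 1 / 3) : D ≤ Rquery f := by
  obtain ⟨Ω, i1, i2, X, hX, hT⟩ := h
  obtain ⟨T0, hT0⟩ := exists_DT_eval f
  obtain ⟨ts, hts, hsum, hcorr⟩ := Nat.sInf_mem (s := {d : ℕ | ∃ ts : List (DT n × ℝ),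
    (∀ p ∈ ts, 0 ≤ p.2 ∧ p.1.depth ≤ d) ∧
    (ts.map Prod.snd).sum = 1 ∧
    ∀ x : Fin n → Bool,
      (2 : ℝ) / 3 ≤ ((ts.filter (fun p => p.1.eval x == f x)).map Prod.snd).sum})
    ⟨T0.depth, [(T0, 1)], by simp, by simp, fun x => by norm_num [hT0]⟩
  change ∀ p ∈ ts, 0 ≤ p.2 ∧ p.1.depth ≤ Rquery f at hts
  by_contra! hlt
  let A : List (DT n × ℝ) → (Fin n → Bool) → ℝ := fun l x =>
    (l.map fun p => p.2 * (QT.ofDT p.1).val x).sum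
  have hone : ∀ (l : List (DT n × ℝ)) x, f x = true →
      ((l.filter (fun p => p.1.eval x == f x)).map Prod.snd).sum = A l x := by
    intro l x hx
    induction l with
    | nil => simp [A]
    | cons p l ih =>
      rw [List.filter_cons]
      cases hp : p.1.eval x <;> simp_all [A, QT.val, QT.eval_ofDT]
  have hzero : ∀ (l : List (DT n × ℝ)) x, f x = false →
      ((l.filter (fun p => p.1.eval x == f x)).map Prod.snd).sum =
        (l.map Prod.snd).sum - A l x := by
    intro l x hx
    induction l with
    | nil => simp [A]
    | cons p l ih =>
      rw [List.filter_cons]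
      cases hp : p.1.eval x <;> simp_all [A, QT.val, QT.eval_ofDT]
      ring
  have hup : ∀ l : List (DT n × ℝ), (∀ p ∈ l, 0 ≤ p.2 ∧ p.1.depth ≤ Rquery f) →
      ∑ ω, (A l (X true ω) - A l (X false ω)) ≤
        δ * Fintype.card Ω * (l.map Prod.snd).sum := by
    intro l hl
    induction l with
    | nil => simp [A]
    | cons p l ih =>
      have h1 := ih fun r hr => hl r (List.mem_cons_of_mem _ hr)
      obtain ⟨hp, hd⟩ := hl p List.mem_cons_self
      have hd' : ((QT.ofDT p.1).depth : ℝ) < D := by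
        rw [QT.depth_ofDT]
        exact lt_of_le_of_lt (by exact_mod_cast hd) hlt
      have h2 := mul_le_mul_of_nonneg_left (abs_le.1 (hT _ hd')).2 hp
      rw [Finset.mul_sum] at h2
      have h3 : ∑ ω, (A (p :: l) (X true ω) - A (p :: l) (X false ω)) =
          ∑ ω, p.2 * ((QT.ofDT p.1).val (X true ω) - (QT.ofDT p.1).val (X false ω)) +
          ∑ ω, (A l (X true ω) - A l (X false ω)) := by
        rw [← Finset.sum_add_distrib]
        refine Finset.sum_congr rfl fun ω _ => ?_
        simp only [A, List.map_cons, List.sum_cons]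
        ring
      rw [h3, List.map_cons, List.sum_cons]
      linarith
  have hlo : ∑ _ω : Ω, (1 / 3 : ℝ) ≤ ∑ ω, (A ts (X true ω) - A ts (X false ω)) := by
    refine Finset.sum_le_sum fun ω _ => ?_
    have h1 := hcorr (X true ω)
    have h0 := hcorr (X false ω)
    rw [hone ts _ (hX true ω)] at h1
    rw [hzero ts _ (hX false ω), hsum] at h0
    linarith
  have hts' := hup ts hts
  have hc : (0 : ℝ) < Fintype.card Ω := by exact_mod_cast Fintype.card_pos
  rw [hsum, mul_one] at hts'
  rw [Finset.sum_const, Finset.card_univ, nsmul_eq_mul] at hlo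
  nlinarith

/-! ### Iterating the construction -/

/-- The disjunction of `n` conjunctions of `n` copies of `g`. -/
def orAnd {J : Type} (n : ℕ) (g : (J → Bool) → Bool) : (Fin n × (Fin n × J) → Bool) → Bool :=
  neg (andC n (neg (andC n g)))

theorem CCert.orAnd {J : Type} {g : (J → Bool) → Bool} {c : ℕ} (h : CCert g fun _ => c) (n : ℕ) :
    CCert (orAnd n g) fun _ => n * c :=
  (((h.andC n).neg).andC n).neg.mono fun b => by cases b <;> simp

theorem UCert.orAnd {J : Type} {g : (J → Bool) → Bool} {c n : ℕ} (hn : 1 ≤ n)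
    (h : UCert g fun b => if b then c else n * c) : UCert (orAnd n g) fun _ => 4 * n ^ 2 * c := by
  have h1 : UCert (_root_.andC n g) fun _ => 2 * n * c :=
    (h.andC n).mono fun b => by cases b <;> simp <;> nlinarith
  have h2 : 2 * n * c ≤ n * (2 * n * c) := Nat.le_mul_of_pos_left _ hn
  refine ((h1.neg).andC n).neg.mono fun b => ?_
  cases b <;> simp <;> nlinarith

theorem Hard.orAnd {J : Type} {g : (J → Bool) → Bool} {D δ q : ℝ} (hD : 0 < D) (hq : 0 < q)
    (h : Hard g D δ) {n : ℕ} (hn : 0 < n) :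
    Hard (orAnd n g) ((n / q) ^ 2 * D) (δ + 2 / q) := by
  have h1 := ((h.andC hD hn q).neg.andC (by positivity) hn q).neg
  have e1 : (n : ℝ) * (n * D / q) / q = (n / q) ^ 2 * D := by ring
  have e2 : δ + 1 / q + 1 / q = δ + 2 / q := by ring
  rwa [e1, e2] at h1

theorem exists_surjective_bits {H : Type} [Fintype H] [Nonempty H] {s : ℕ}
    (hs : Fintype.card H ≤ 2 ^ s) : ∃ dec : (Fin s → Bool) → H, Function.Surjective dec := by
  obtain ⟨f⟩ : Nonempty (H ↪ (Fin s → Bool)) :=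
    Function.Embedding.nonempty_of_card_le (by simpa using hs)
  exact ⟨Function.invFun f, Function.invFun_surjective f.injective⟩

theorem card_CSIdx_le {H : Type} [Fintype H] {t w s : ℕ} (hs : Fintype.card H ≤ 2 ^ s)
    (hw : w ≤ 2 ^ s) : Fintype.card (CSIdx H t w s) ≤ 2 ^ (2 * t + 2 * s + 2) := by
  have ht : t ≤ 2 ^ t := Nat.lt_two_pow_self.le
  have hss : s ≤ 2 ^ s := Nat.lt_two_pow_self.le
  have h1 : Fintype.card (CSIdx H t w s) =
      t * Fintype.card H + 2 ^ t * (t * (w * s) + 1) := by simp [CSIdx]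
  have h2 : t * Fintype.card H ≤ 2 ^ t * 2 ^ s := Nat.mul_le_mul ht hs
  have h3 : t * (w * s) ≤ 2 ^ t * (2 ^ s * 2 ^ s) := Nat.mul_le_mul ht (Nat.mul_le_mul hw hss)
  have h4 : 2 ^ t * (t * (w * s) + 1) ≤ 2 ^ t * (2 ^ t * (2 ^ s * 2 ^ s) + 1) :=
    Nat.mul_le_mul_left _ (by omega)
  have h5 : (2 : ℕ) ^ (2 * t + 2 * s + 2) = 4 * ((2 ^ t * 2 ^ t) * (2 ^ s * 2 ^ s)) := by ring
  have h6 : 1 ≤ 2 ^ t := Nat.one_le_two_pow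
  have h7 : 1 ≤ 2 ^ s := Nat.one_le_two_pow
  rw [h1, h5]
  generalize 2 ^ t = a at *
  generalize 2 ^ s = b at *
  have h8 : a * b ≤ (a * a) * (b * b) := Nat.mul_le_mul (Nat.le_mul_of_pos_left a h6)
    (Nat.le_mul_of_pos_left b h7)
  have h9 : a * 1 ≤ a * b := Nat.mul_le_mul_left a h7
  nlinarith

theorem cheatSheet_bound {t w v s a Λ : ℕ} (ht : 1 ≤ t) (ha : 1 ≤ a) (hw : w ≤ a)
    (hv : v ≤ 4 * a) (h : t * (s + 6) ≤ Λ) : t * (w + v) + (t * (w * s) + 1) ≤ a * Λ := by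
  calc t * (w + v) + (t * (w * s) + 1) ≤ t * (a + 4 * a) + (t * (a * s) + t * a) := by
        gcongr
        exact Nat.mul_le_mul ht ha
    _ = a * (t * (s + 6)) := by ring
    _ ≤ a * Λ := Nat.mul_le_mul_left _ h

/-- The functions obtained by iterating composition with `orAnd` and the cheat sheet
construction, with `m = log n` and addresses of length `t`. -/
theorem exists_iterated_cheatSheet {m t K q : ℕ} (hm : 1 ≤ m) (hmt : m ≤ t) (hq : 1 ≤ q)
    (ht : q * (2 ^ m) ^ (2 * K) ≤ 2 ^ t) (k : ℕ) (hk : k ≤ K) :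
    ∃ (ι : Type) (_ : Fintype ι) (_ : Nonempty ι) (g : (ι → Bool) → Bool),
      Fintype.card ι ≤ 2 ^ (8 * t * 3 ^ k) ∧
      CCert g (fun _ => (2 ^ m) ^ k * (16 * 3 ^ K * t ^ 2) ^ k) ∧
      UCert g (fun b => if b then (2 ^ m) ^ k * (16 * 3 ^ K * t ^ 2) ^ k
        else 2 ^ m * ((2 ^ m) ^ k * (16 * 3 ^ K * t ^ 2) ^ k)) ∧
      Hard g (((2 ^ m : ℕ) / q : ℝ) ^ (2 * k)) (3 * k * t ^ k / q) := by
  have ht1 : 1 ≤ t := hm.trans hmt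
  have hn1 : 1 ≤ 2 ^ m := Nat.one_le_two_pow
  induction k with
  | zero =>
    refine ⟨Unit, inferInstance, inferInstance, fun x => x (), by simpa using Nat.one_le_two_pow,
      ⟨fun _ => Finset.univ, fun x => ⟨by simp, fun y hy => hy () (Finset.mem_univ _)⟩⟩,
      ⟨fun _ => Finset.univ, fun x => ⟨by
        simp only [Finset.card_univ, Fintype.card_unit, pow_zero, mul_one]
        split_ifs <;> omega, fun y hy =>
        ⟨hy () (Finset.mem_univ _), rfl⟩⟩⟩,
      ⟨Unit, inferInstance, inferInstance, fun b _ _ => b, fun b ω => rfl, fun T hT => ?_⟩⟩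
    cases T with
    | leaf c => cases c <;> simp [QT.val, QT.eval]
    | node i t0 t1 =>
      simp only [QT.depth, Nat.mul_zero, pow_zero, Nat.cast_lt_one] at hT
      omega
  | succ k ih =>
    obtain ⟨ι, i1, i2, g, hcard, hC, hU, hH⟩ := ih (by omega)
    set n := 2 ^ m with hn
    set Λ := 16 * 3 ^ K * t ^ 2 with hΛ
    set c := n ^ k * Λ ^ k with hc
    set s := 8 * t * 3 ^ k + 2 * m with hs
    have hΛ1 : 1 ≤ Λ := Nat.one_le_iff_ne_zero.2 (by positivity)
    have hc1 : 1 ≤ c := Nat.one_le_iff_ne_zero.2 (by positivity)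
    have : Nonempty (Fin n) := ⟨⟨0, hn1⟩⟩
    have hHs : Fintype.card (Fin n × (Fin n × ι)) ≤ 2 ^ s := by
      simp only [Fintype.card_prod, Fintype.card_fin]
      calc n * (n * Fintype.card ι) ≤ n * (n * 2 ^ (8 * t * 3 ^ k)) := by gcongr
        _ = 2 ^ s := by rw [hn, hs]; ring
    obtain ⟨dec, hdec⟩ := exists_surjective_bits hHs
    set w := min (n * c) (Fintype.card (Fin n × (Fin n × ι))) with hw
    have hwc : w ≤ n * c := min_le_left _ _
    have hC' := hC.orAnd n
    have hU' := hU.orAnd hn1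
    have hqR : (0 : ℝ) < q := by exact_mod_cast hq
    have hnR : (0 : ℝ) < n := by exact_mod_cast hn1
    have hH' := hH.orAnd (by positivity) hqR hn1
    have h3k : 3 ^ k ≤ 3 ^ K := Nat.pow_le_pow_right (by norm_num) (by omega)
    have h3K : 1 ≤ 3 ^ K := Nat.one_le_iff_ne_zero.2 (by positivity)
    have hsb : t * (s + 6) ≤ Λ := by
      have : s + 6 ≤ 16 * 3 ^ K * t := by
        have := Nat.mul_le_mul_left (8 * t) h3k
        have := Nat.mul_le_mul_left (8 * t) h3K
        rw [hs]
        nlinarith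
      calc t * (s + 6) ≤ t * (16 * 3 ^ K * t) := Nat.mul_le_mul_left _ this
        _ = Λ := by rw [hΛ]; ring
    have hnc : 1 ≤ n * c := Nat.one_le_iff_ne_zero.2 (by positivity)
    have hcc : n ^ (k + 1) * Λ ^ (k + 1) = n * c * Λ := by rw [hc]; ring
    rw [hcc]
    refine ⟨CSIdx (Fin n × (Fin n × ι)) t w s, inferInstance, inferInstance,
      cheatSheet (orAnd n g) dec, ?_, ?_, ?_, ?_⟩
    · refine (card_CSIdx_le hHs ((min_le_right _ _).trans hHs)).trans ?_
      refine Nat.pow_le_pow_right (by norm_num) ?_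
      have : 1 ≤ 3 ^ k := Nat.one_le_iff_ne_zero.2 (by positivity)
      rw [hs, pow_succ]
      nlinarith
    · exact (hC'.min_card.cheatSheet dec).mono fun _ =>
        cheatSheet_bound ht1 hnc hwc (hwc.trans (by omega)) hsb
    · refine (hU'.cheatSheet dec).mono fun b => ?_
      cases b
      · simp only [Bool.false_eq_true, if_false]
        rw [← mul_assoc n]
        have hnnc : n * c ≤ n * (n * c) := Nat.le_mul_of_pos_left _ hn1
        exact cheatSheet_bound ht1 (hnc.trans hnnc) (hwc.trans hnnc) (le_of_eq (by ring)) hsb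
      · simpa using cheatSheet_bound ht1 hnc hwc (Nat.zero_le _) hsb
    · have he : ((n : ℝ) / q) ^ 2 * ((n : ℝ) / q) ^ (2 * k) = ((n : ℝ) / q) ^ (2 * (k + 1)) := by
        ring
      rw [he] at hH'
      have hDb : (q : ℝ) * ((n : ℝ) / q) ^ (2 * (k + 1)) ≤ 2 ^ t := by
        have h1 : ((n : ℝ) / q) ^ (2 * (k + 1)) ≤ (n : ℝ) ^ (2 * K) := by
          calc ((n : ℝ) / q) ^ (2 * (k + 1)) ≤ (n : ℝ) ^ (2 * (k + 1)) := by
                gcongr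
                exact div_le_self hnR.le (by exact_mod_cast hq)
            _ ≤ (n : ℝ) ^ (2 * K) := pow_le_pow_right₀ (by exact_mod_cast hn1) (by omega)
        calc (q : ℝ) * ((n : ℝ) / q) ^ (2 * (k + 1)) ≤ q * (n : ℝ) ^ (2 * K) := by gcongr
          _ ≤ 2 ^ t := by exact_mod_cast ht
      refine (Hard.cheatSheet hdec hC'.min_card (by positivity) hH' hqR hDb).mono ?_
      have htR : (1 : ℝ) ≤ t := by exact_mod_cast ht1
      have htk : (t : ℝ) ≤ t ^ (k + 1) := le_self_pow₀ htR (by omega)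
      have e1 : (t : ℝ) * (3 * k * t ^ k / q + 2 / q) + 1 / q =
          (3 * k * t ^ (k + 1) + 2 * t + 1) / q := by ring
      rw [e1]
      push_cast
      gcongr
      linarith

/-- Polynomials are eventually smaller than exponentials. -/
theorem exists_mul_pow_le_two_pow (C e M : ℕ) : ∃ m, 1 ≤ m ∧ M ≤ m ∧ C * m ^ e ≤ 2 ^ m := by
  have h := tendsto_pow_const_div_const_pow_of_one_lt e (one_lt_two : (1 : ℝ) < 2)
  have hC : (0 : ℝ) < 1 / (C + 1) := by positivity
  obtain ⟨m, hm, hm'⟩ := ((h.eventually_lt_const hC).and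
    (Filter.eventually_ge_atTop (M + 1))).exists
  refine ⟨m, by omega, by omega, ?_⟩
  rw [div_lt_div_iff₀ (by positivity) (by positivity), one_mul] at hm
  have : ((C * m ^ e : ℕ) : ℝ) ≤ (2 ^ m : ℕ) := by
    push_cast
    have : (0 : ℝ) ≤ (m : ℝ) ^ e := by positivity
    nlinarith
  exact_mod_cast this

/-- The separation with explicit parameters. -/
theorem exists_UC_le_and_le_Rquery (K M : ℕ) : ∃ (N : ℕ) (f : (Fin N → Bool) → Bool) (n L q : ℕ),
    1 ≤ n ∧ 1 ≤ L ∧ 1 ≤ q ∧ M ≤ UC f ∧ n ≤ UC f ∧ UC f ≤ L * n ^ (K + 1) ∧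
      L ^ 2 * q ^ (2 * K + 1) ≤ n ∧ ((n : ℝ) / q) ^ (2 * K + 1) ≤ Rquery f := by
  obtain ⟨m, hm, hMm, hbig⟩ := exists_mul_pow_le_two_pow
    ((2 * (16 * 3 ^ K * (2 * K + 1) ^ 2) ^ K) ^ 2 *
      (10 * (K + 1) * (2 * K + 1) ^ K) ^ (2 * K + 1)) (4 * K + K * (2 * K + 1)) M
  set t := (2 * K + 1) * m with ht
  set q := 10 * (K + 1) * t ^ K with hq
  set Λ := 16 * 3 ^ K * t ^ 2 with hΛ
  have ht1 : 1 ≤ t := Nat.one_le_iff_ne_zero.2 (by positivity)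
  have hq1 : 1 ≤ q := Nat.one_le_iff_ne_zero.2 (by positivity)
  have hΛ1 : 1 ≤ Λ := Nat.one_le_iff_ne_zero.2 (by positivity)
  have hn1 : 1 ≤ 2 ^ m := Nat.one_le_two_pow
  have hL1 : 1 ≤ 2 * Λ ^ K := Nat.one_le_iff_ne_zero.2 (by positivity)
  have hmain : (2 * Λ ^ K) ^ 2 * q ^ (2 * K + 1) ≤ 2 ^ m := by
    have hA : Λ = 16 * 3 ^ K * (2 * K + 1) ^ 2 * m ^ 2 := by rw [hΛ, ht]; ring
    have hB : q = 10 * (K + 1) * (2 * K + 1) ^ K * m ^ K := by rw [hq, ht, mul_pow]; ring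
    refine le_of_eq_of_le ?_ hbig
    rw [hA, hB]
    generalize 16 * 3 ^ K * (2 * K + 1) ^ 2 = A
    generalize 10 * (K + 1) * (2 * K + 1) ^ K = B
    ring
  have hqn : q ≤ 2 ^ m := by
    refine le_trans ?_ hmain
    calc q = 1 * q ^ 1 := by ring
      _ ≤ (2 * Λ ^ K) ^ 2 * q ^ (2 * K + 1) :=
        Nat.mul_le_mul (Nat.one_le_pow _ _ hL1) (Nat.pow_le_pow_right hq1 (by omega))
  have hqt : q * (2 ^ m) ^ (2 * K) ≤ 2 ^ t := by
    calc q * (2 ^ m) ^ (2 * K) ≤ 2 ^ m * (2 ^ m) ^ (2 * K) := Nat.mul_le_mul_right _ hqn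
      _ = 2 ^ t := by rw [ht]; ring
  have hmt : m ≤ t := Nat.le_mul_of_pos_left m (by omega)
  obtain ⟨ι, i1, i2, g, -, -, hU, hH⟩ := exists_iterated_cheatSheet hm hmt hq1 hqt K le_rfl
  rw [← hΛ] at hU
  set n := 2 ^ m with hn
  let e : Fin n × ι ≃ Fin (Fintype.card (Fin n × ι)) := Fintype.equivFin _
  have hqR : (0 : ℝ) < q := by exact_mod_cast hq1
  have hnR : (0 : ℝ) < n := by exact_mod_cast hn1
  have hU1 : UCert (andC n g) fun _ => 2 * Λ ^ K * n ^ (K + 1) := by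
    refine (hU.andC n).mono fun b => ?_
    have : 2 * Λ ^ K * n ^ (K + 1) = 2 * (n * (n ^ K * Λ ^ K)) := by ring
    rw [this]
    cases b <;> simp <;> omega
  have hU2 := hU1.comp_equiv e
  have hH2 := (hH.andC (by positivity) hn1 q).comp_equiv e
  obtain ⟨z0, hz0⟩ := hH.exists_eq false
  obtain ⟨z1, hz1⟩ := hH.exists_eq true
  have hlow : n ≤ UC fun y => andC n g (y ∘ e) := by
    refine hU2.le_UC (fun v => z1 (e.symm v).2) ?_ fun p hp hx => le_paWidth_andC e hz0 hp hx
    have hb : ∀ i, blk ((fun v => z1 (e.symm v).2) ∘ e) i = z1 := by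
      intro i
      funext j
      simp [blk]
    simp [andC, hb, hz1]
  refine ⟨_, fun y => andC n g (y ∘ e), n, 2 * Λ ^ K, q, hn1, hL1, hq1,
    (hMm.trans Nat.lt_two_pow_self.le).trans hlow, hlow, hU2.UC_le, hmain, ?_⟩
  refine le_of_eq_of_le (by ring) (hH2.le_Rquery ?_)
  have htk : (1 : ℝ) ≤ (t : ℝ) ^ K := one_le_pow₀ (by exact_mod_cast ht1)
  have hqe : (q : ℝ) = 10 * (K + 1) * t ^ K := by rw [hq]; push_cast; ring
  rw [← add_div, div_lt_div_iff₀ hqR (by norm_num), hqe]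
  have : (0 : ℝ) ≤ K * (t : ℝ) ^ K := by positivity
  nlinarith

theorem stmt2 (ε : ℝ) (hε : 0 < ε) (M : ℕ) :
    ∃ (n : ℕ) (f : (Fin n → Bool) → Bool),
      M ≤ UC f ∧ (UC f : ℝ) ^ ((2 : ℝ) - ε) ≤ (Rquery f : ℝ) := by
  set η := min ε 1 with hη
  have hη0 : 0 < η := lt_min hε one_pos
  obtain ⟨K, hK⟩ := exists_nat_ge (2 / η)
  obtain ⟨N, f, n, L, q, hn, hL, hq, hM, hlow, hup, hmain, hR⟩ := exists_UC_le_and_le_Rquery K M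
  refine ⟨N, f, hM, le_trans ?_ hR⟩
  have hnR : (1 : ℝ) ≤ n := by exact_mod_cast hn
  have hLR : (1 : ℝ) ≤ L := by exact_mod_cast hL
  have hqR : (0 : ℝ) < q := by exact_mod_cast hq
  have hU1 : (1 : ℝ) ≤ UC f := by exact_mod_cast hn.trans hlow
  have hKη : 2 ≤ K * η := (div_le_iff₀ hη0).1 hK
  have hη1 : η ≤ 1 := min_le_right _ _
  calc (UC f : ℝ) ^ (2 - ε) ≤ (UC f : ℝ) ^ (2 - η) :=
        Real.rpow_le_rpow_of_exponent_le hU1 (by linarith [min_le_left ε 1])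
    _ ≤ ((L : ℝ) * (n : ℝ) ^ (K + 1)) ^ (2 - η) :=
        Real.rpow_le_rpow (by positivity) (by exact_mod_cast hup) (by linarith)
    _ = (L : ℝ) ^ (2 - η) * (n : ℝ) ^ (((K + 1 : ℕ) : ℝ) * (2 - η)) := by
        rw [Real.mul_rpow (by positivity) (by positivity), Real.rpow_natCast_mul (by positivity)]
    _ ≤ (L : ℝ) ^ ((2 : ℕ) : ℝ) * (n : ℝ) ^ ((2 * K : ℕ) : ℝ) := by
        refine mul_le_mul (Real.rpow_le_rpow_of_exponent_le hLR ?_)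
          (Real.rpow_le_rpow_of_exponent_le hnR ?_) (by positivity) (by positivity)
        · push_cast
          linarith
        · push_cast
          nlinarith
    _ = (L : ℝ) ^ 2 * (n : ℝ) ^ (2 * K) := by rw [Real.rpow_natCast, Real.rpow_natCast]
    _ ≤ ((n : ℝ) / q) ^ (2 * K + 1) := by
        rw [div_pow, le_div_iff₀ (by positivity)]
        have h1 : (L : ℝ) ^ 2 * (q : ℝ) ^ (2 * K + 1) ≤ n := by exact_mod_cast hmain
        calc (L : ℝ) ^ 2 * (n : ℝ) ^ (2 * K) * (q : ℝ) ^ (2 * K + 1)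
            = (L : ℝ) ^ 2 * (q : ℝ) ^ (2 * K + 1) * (n : ℝ) ^ (2 * K) := by ring
          _ ≤ n * (n : ℝ) ^ (2 * K) := by gcongr
          _ = (n : ℝ) ^ (2 * K + 1) := by ring
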